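/- For every k ≥ 1, there is a bijection between the set of Schröder paths (of arbitrary semilength) consisting of exactly k steps in which every diagonal step is immediately followed by a horizontal step except if it is the last step, and the set RMP(k) of Motzkin paths of length k in which every horizontal step is immediately followed by an up step except if it is the last step. -/

import Mathlib

/-! Schröder paths -/

inductive SStep : Type
  | H | V | D
deriving DecidableEq

def SStep.dx : SStep → ℕ
  | .H => 1 | .V => 0 | .D => 1

def SStep.dy : SStep → ℕ
  | .H => 0 | .V => 1 | .D => 1

def pathX (p : List SStep) : ℕ := (p.map SStep.dx).sum
def pathY (p : List SStep) : ℕ := (p.map SStep.dy).sum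

/-- A Schröder path of semilength `n`: from (0,0) to (n,n), steps H,V,D,
never rising above the diagonal. -/
def IsSchroder (n : ℕ) (p : List SStep) : Prop :=
  pathX p = n ∧ pathY p = n ∧ ∀ q : List SStep, q <+: p → pathY q ≤ pathX q

/-- No diagonal step starts on the diagonal. -/
def DiagFree (p : List SStep) : Prop :=
  ∀ q r : List SStep, p = q ++ SStep.D :: r → pathX q ≠ pathY q

/-- Every diagonal step is immediately followed by a horizontal step,
except if it is the last step. -/
def DFollowedByH (p : List SStep) : Prop :=
  ∀ q r : List SStep, p = q ++ SStep.D :: r → r = [] ∨ ∃ r' : List SStep, r = SStep.H :: r'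

def SP (n m : ℕ) : Type := {p : List SStep // IsSchroder n p ∧ p.count SStep.D + m = n}
def SPplus (n m : ℕ) : Type :=
  {p : List SStep // IsSchroder n p ∧ p.count SStep.D + m = n ∧ DiagFree p}
def SPzero (n m : ℕ) : Type :=
  {p : List SStep // IsSchroder n p ∧ p.count SStep.D + m = n ∧ ¬ DiagFree p}
def RP (n m : ℕ) : Type :=
  {p : List SStep // IsSchroder n p ∧ p.count SStep.D + m = n ∧ DFollowedByH p}

/-! Rooted planar trees -/

inductive PTree : Type
  | node : List PTree → PTree

namespace PTree

def leaves : PTree → ℕ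
  | node [] => 1
  | node (c :: cs) => ((c :: cs).attach.map fun x => leaves x.1).sum
decreasing_by
  have := List.sizeOf_lt_of_mem x.2
  simp only [PTree.node.sizeOf_spec, List.cons.sizeOf_spec] at this ⊢
  omega

def internal : PTree → ℕ
  | node [] => 0
  | node (c :: cs) => 1 + ((c :: cs).attach.map fun x => internal x.1).sum
decreasing_by
  have := List.sizeOf_lt_of_mem x.2
  simp only [PTree.node.sizeOf_spec, List.cons.sizeOf_spec] at this ⊢
  omega

def Good : PTree → Prop
  | node cs => cs.length ≠ 1 ∧ ∀ c ∈ cs.attach, Good c.1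
decreasing_by
  have := List.sizeOf_lt_of_mem c.2
  simp only [PTree.node.sizeOf_spec] at this ⊢
  omega

end PTree

def PT (n m : ℕ) : Type :=
  {t : PTree // t.Good ∧ t.leaves = n + 1 ∧ t.internal = m}

def PTn (n : ℕ) : Type := {t : PTree // t.Good ∧ t.leaves = n + 1}

/-! Motzkin paths -/

inductive MStep : Type
  | U | H | D
deriving DecidableEq

def MStep.dh : MStep → ℤ
  | .U => 1 | .H => 0 | .D => -1

def mHeight (p : List MStep) : ℤ := (p.map MStep.dh).sum

def IsMotzkin (k : ℕ) (p : List MStep) : Prop :=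
  p.length = k ∧ mHeight p = 0 ∧ ∀ q : List MStep, q <+: p → 0 ≤ mHeight q

def HFollowedByU (p : List MStep) : Prop :=
  ∀ q r : List MStep, p = q ++ MStep.H :: r → r = [] ∨ ∃ r' : List MStep, r = MStep.U :: r'

def MP (k : ℕ) : Type := {p : List MStep // IsMotzkin k p}
def RMP (k : ℕ) : Type := {p : List MStep // IsMotzkin k p ∧ HFollowedByU p}

/-- Motzkin steps with two possible colors on up and horizontal steps. -/
inductive CMStep : Type
  | U : Bool → CMStep
  | H : Bool → CMStep
  | D : CMStep
deriving DecidableEq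

def CMStep.forget : CMStep → MStep
  | .U _ => .U | .H _ => .H | .D => .D

/-- (h,u)-colored Motzkin paths of length n-1. -/
def huMP (n : ℕ) : Type := {p : List CMStep // IsMotzkin (n - 1) (p.map CMStep.forget)}


/-- Schröder paths (of arbitrary semilength) with exactly k steps in which every
diagonal step is immediately followed by a horizontal step, except the last step. -/
def RPWithSteps (k : ℕ) : Type :=
  {p : List SStep // (∃ n : ℕ, IsSchroder n p) ∧ p.length = k ∧ DFollowedByH p}

/-- The stepwise relabelling of Schröder steps as Motzkin steps, matching the distance
below the diagonal with the height. -/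
def stepEquiv : SStep ≃ MStep where
  toFun
    | .H => .U
    | .V => .D
    | .D => .H
  invFun
    | .U => .H
    | .D => .V
    | .H => .D
  left_inv := by rintro (_ | _ | _) <;> rfl
  right_inv := by rintro (_ | _ | _) <;> rfl

theorem mHeight_map_stepEquiv (p : List SStep) :
    mHeight (p.map stepEquiv) = (pathX p : ℤ) - pathY p := by
  induction p with
  | nil => rfl
  | cons s p ih =>
    have hs : (stepEquiv s).dh = (s.dx : ℤ) - s.dy := by cases s <;> rfl
    simp only [mHeight, pathX, pathY, List.map_cons, List.sum_cons] at ih ⊢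
    omega

theorem isMotzkin_map_stepEquiv (k : ℕ) (p : List SStep) :
    IsMotzkin k (p.map stepEquiv) ↔ (∃ n, IsSchroder n p) ∧ p.length = k := by
  have hprefix : (∀ q, q <+: p.map stepEquiv → 0 ≤ mHeight q) ↔
      ∀ q, q <+: p → pathY q ≤ pathX q := by
    simp only [List.prefix_map_iff, forall_exists_index, and_imp]
    constructor
    · intro h q hq
      have := h _ q hq rfl
      rw [mHeight_map_stepEquiv] at this
      omega
    · rintro h _ q hq rfl
      have := h q hq
      rw [mHeight_map_stepEquiv]
      omega
  simp only [IsMotzkin, IsSchroder, hprefix, mHeight_map_stepEquiv, List.length_map]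
  constructor
  · rintro ⟨hk, h, hp⟩
    exact ⟨⟨pathX p, rfl, by omega, hp⟩, hk⟩
  · rintro ⟨⟨n, hx, hy, hp⟩, hk⟩
    exact ⟨hk, by omega, hp⟩

theorem hFollowedByU_map_stepEquiv (p : List SStep) :
    HFollowedByU (p.map stepEquiv) ↔ DFollowedByH p := by
  constructor
  · rintro h q r rfl
    rcases h (q.map stepEquiv) (r.map stepEquiv) (by simp [stepEquiv]) with hr | ⟨r', hr⟩
    · exact Or.inl (List.map_eq_nil_iff.mp hr)
    · obtain ⟨s, t, rfl, hs, -⟩ := List.map_eq_cons_iff.mp hr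
      obtain rfl : s = SStep.H := stepEquiv.injective hs
      exact Or.inr ⟨t, rfl⟩
  · intro h q r hp
    obtain ⟨q', t, rfl, rfl, ht⟩ := List.map_eq_append_iff.mp hp
    obtain ⟨s, r', rfl, hs, rfl⟩ := List.map_eq_cons_iff.mp ht
    obtain rfl : s = SStep.D := stepEquiv.injective hs
    rcases h q' r' rfl with rfl | ⟨r'', rfl⟩
    · exact Or.inl rfl
    · exact Or.inr ⟨r''.map stepEquiv, rfl⟩

/-- these are in bijection with Motzkin paths of length k in which every
horizontal step is immediately followed by an up step, except the last step. -/
theorem statement10 (k : ℕ) (hk : 1 ≤ k) : Nonempty (RPWithSteps k ≃ RMP k) := by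
  exact ⟨(Equiv.listEquivOfEquiv stepEquiv).subtypeEquiv fun p => by
    change _ ↔ IsMotzkin k (p.map stepEquiv) ∧ HFollowedByU (p.map stepEquiv)
    rw [isMotzkin_map_stepEquiv, hFollowedByU_map_stepEquiv, and_assoc]⟩
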